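/- arXiv:1504.05151 — 2 statements merged into one kernel-verified Lean document; each statement's English description precedes it below -/
import Mathlib

section
/- Let K be a field of characteristic zero, let e_0,…,e_4 be the coordinate points of P^4 over K, and let S ⊂ P^4 consist of the seven points e_0, e_1, e_2, e_3, e_4, [1:1:1:1:0] (the point e_0+e_1+e_2+e_3) and [1:1:−1:0:1] (the point e_0+e_1−e_2+e_4). Let Z = Σ_{p ∈ S} 3·p be the scheme of seven triple points supported on S. Then dim_K (R/I_Z)_5 = 7·C(6,4) = 105, i.e. h^1(I_Z(5)) = 0. -/
open MvPolynomial Module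

/-- The homogeneous prime ideal of the point of `ℙⁿ` with homogeneous coordinate vector `v`:
the ideal generated by the linear forms vanishing at `v`. -/
noncomputable def pointIdealV {K : Type*} [Field K] {n : ℕ} (v : Fin (n + 1) → K) :
    Ideal (MvPolynomial (Fin (n + 1)) K) :=
  Ideal.span {f | ∃ c : Fin (n + 1) → K,
    (∑ i, c i * v i) = 0 ∧ f = ∑ i, MvPolynomial.C (c i) * MvPolynomial.X i}

/-- `dim_K (R/I)_d`: the dimension of the degree-`d` graded piece of `R/I`. -/
noncomputable def hilbDim {K : Type*} [Field K] {n : ℕ}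
    (I : Ideal (MvPolynomial (Fin (n + 1)) K)) (d : ℕ) : ℕ :=
  Module.finrank K (Submodule.map (Ideal.Quotient.mkₐ K I).toLinearMap
    (homogeneousSubmodule (Fin (n + 1)) K d))

/-- The seven points of `ℙ⁴` of Lemma `sssr1`, case `a = 3` (Macaulay2 Code 1): the five
coordinate points `e₀,…,e₄` together with `e₀+e₁+e₂+e₃` and `e₀+e₁−e₂+e₄`. -/
noncomputable def ptsSSSR1 (K : Type*) [Field K] : Fin 7 → Fin 5 → K :=
  ![![1, 0, 0, 0, 0], ![0, 1, 0, 0, 0], ![0, 0, 1, 0, 0], ![0, 0, 0, 1, 0],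
    ![0, 0, 0, 0, 1], ![1, 1, 1, 1, 0], ![1, 1, -1, 0, 1]]

section LinearAlgebra

variable {K V W ι : Type*} [Field K] [AddCommGroup V] [Module K V] [AddCommGroup W] [Module K W]

theorem linearIndependent_of_triangular [Finite ι] (rank : ι → ℕ) (f : ι → V →ₗ[K] K) (x : ι → V)
    (hdiag : ∀ k, f k (x k) ≠ 0)
    (hoff : ∀ k l, l ≠ k → rank k ≤ rank l → f l (x k) = 0) : LinearIndependent K f := by
  have := Fintype.ofFinite ι
  rw [Fintype.linearIndependent_iff]
  intro g hg
  suffices ∀ n k, rank k = n → g k = 0 from fun k => this _ k rfl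
  intro n
  induction n using Nat.strong_induction_on with
  | _ n ih =>
    intro k hk
    have h := LinearMap.congr_fun hg (x k)
    simp only [LinearMap.sum_apply, LinearMap.smul_apply, smul_eq_mul, LinearMap.zero_apply] at h
    rw [Finset.sum_eq_single k] at h
    · exact (mul_eq_zero.mp h).resolve_right (hdiag k)
    · intro l _ hl
      rcases lt_or_ge (rank l) (rank k) with hlt | hge
      · rw [ih _ (hk ▸ hlt) l rfl, zero_mul]
      · rw [hoff k l hl hge, mul_zero]
    · simp

theorem LinearMap.exists_comp_eq_of_ker_le_ker (p : V →ₗ[K] W) (f : V →ₗ[K] K)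
    (h : p.ker ≤ f.ker) : ∃ g : W →ₗ[K] K, g ∘ₗ p = f := by
  have hf : f ∈ p.dualMap.range := by
    rw [LinearMap.range_dualMap_eq_dualAnnihilator_ker, Submodule.mem_dualAnnihilator]
    exact fun w hw => h hw
  obtain ⟨g, hg⟩ := hf
  exact ⟨g, hg⟩

theorem card_le_finrank_map_of_triangular [Fintype ι] (p : V →ₗ[K] W) (S : Submodule K V)
    [FiniteDimensional K S] (rank : ι → ℕ) (f : ι → V →ₗ[K] K) (x : ι → V)
    (hker : ∀ k, p.ker ≤ (f k).ker) (hx : ∀ k, x k ∈ S) (hdiag : ∀ k, f k (x k) ≠ 0)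
    (hoff : ∀ k l, l ≠ k → rank k ≤ rank l → f l (x k) = 0) :
    Fintype.card ι ≤ finrank K (S.map p) := by
  choose g hg using fun k => p.exists_comp_eq_of_ker_le_ker (f k) (hker k)
  have hgx : ∀ k v, g k (p v) = f k v := fun k v => LinearMap.congr_fun (hg k) v
  have hli : LinearIndependent K fun k => (g k).domRestrict (S.map p) :=
    linearIndependent_of_triangular rank _ (fun k => ⟨p (x k), Submodule.mem_map_of_mem (hx k)⟩)
      (fun k => by simpa [hgx] using hdiag k)
      (fun k l hl hr => by simpa [hgx] using hoff k l hl hr)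
  calc Fintype.card ι ≤ finrank K (Dual K (S.map p)) := hli.fintype_card_le_finrank
    _ = finrank K (S.map p) := Subspace.dual_finrank_eq

end LinearAlgebra

theorem Submodule.sup_pow_add_le {K A : Type*} [CommRing K] [CommRing A] [Algebra K A]
    (L P : Submodule K A) (p : Ideal A) (hP : P ≤ p.restrictScalars K) (k j : ℕ) :
    (L ⊔ P) ^ (j + k) ≤ L ^ j * (L ⊔ P) ^ k ⊔ (p ^ (k + 1)).restrictScalars K := by
  have hPp : ∀ n, P * (p ^ n).restrictScalars K ≤ (p ^ (n + 1)).restrictScalars K := fun n =>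
    Submodule.mul_le.mpr fun a ha b hb => by
      rw [Submodule.restrictScalars_mem] at hb ⊢
      rw [pow_succ']
      exact Ideal.mul_mem_mul (hP ha) hb
  have hL : ∀ n, L * (p ^ n).restrictScalars K ≤ (p ^ n).restrictScalars K := fun n =>
    Submodule.mul_le.mpr fun a _ b hb => Ideal.mul_mem_left _ _ hb
  induction k generalizing j with
  | zero =>
    induction j with
    | zero => simp
    | succ j ih =>
      have hPr : P * (L ⊔ P) ^ j ≤ (p ^ (0 + 1)).restrictScalars K :=
        Submodule.mul_le.mpr fun a ha b _ => by
          simpa using Ideal.mul_mem_right b p (hP ha)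
      calc (L ⊔ P) ^ (j + 1 + 0) = L * (L ⊔ P) ^ (j + 0) ⊔ P * (L ⊔ P) ^ j := by
            rw [add_zero, add_zero, pow_succ', Submodule.sup_mul]
        _ ≤ L * (L ^ j * (L ⊔ P) ^ 0 ⊔ (p ^ (0 + 1)).restrictScalars K) ⊔
            (p ^ (0 + 1)).restrictScalars K := by gcongr
        _ ≤ _ := by
          rw [Submodule.mul_sup, ← mul_assoc, ← pow_succ', sup_assoc]
          exact sup_le_sup le_rfl (sup_le (hL _) le_rfl)
  | succ k ihk =>
    induction j with
    | zero => simp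
    | succ j ih =>
      have hLP : L ^ (j + 1) * (P * (L ⊔ P) ^ k) ≤ L ^ (j + 1) * (L ⊔ P) ^ (k + 1) := by
        rw [pow_succ' (L ⊔ P)]
        gcongr
        exact le_sup_right
      calc (L ⊔ P) ^ (j + 1 + (k + 1))
          = L * (L ⊔ P) ^ (j + (k + 1)) ⊔ P * (L ⊔ P) ^ (j + 1 + k) := by
            rw [show j + 1 + (k + 1) = j + (k + 1) + 1 by ring, pow_succ', Submodule.sup_mul,
              show j + (k + 1) = j + 1 + k by ring]
        _ ≤ L * (L ^ j * (L ⊔ P) ^ (k + 1) ⊔ (p ^ (k + 1 + 1)).restrictScalars K) ⊔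
            P * (L ^ (j + 1) * (L ⊔ P) ^ k ⊔ (p ^ (k + 1)).restrictScalars K) := by
          gcongr
          exact ihk (j + 1)
        _ ≤ _ := by
          rw [Submodule.mul_sup, Submodule.mul_sup, ← mul_assoc, ← pow_succ',
            mul_left_comm P]
          exact sup_le (sup_le le_sup_left ((hL _).trans le_sup_right))
            (sup_le (hLP.trans le_sup_left) ((hPp _).trans le_sup_right))

section FatPoints

variable {K : Type*} [Field K] {n : ℕ}

theorem MvPolynomial.finrank_homogeneousSubmodule {σ : Type*} [Fintype σ] (d : ℕ) :
    finrank K (homogeneousSubmodule σ K d) = (Fintype.card σ + d - 1).choose d := by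
  classical
  have hset : {a : σ →₀ ℕ | a.degree = d} = ↑(Finset.univ.finsuppAntidiag d : Finset (σ →₀ ℕ)) := by
    ext a
    simp [Finsupp.degree_eq_sum]
  rw [homogeneousSubmodule_eq_finsupp_supported, hset,
    (AddMonoidAlgebra.supportedEquivFinsupp _).finrank_eq, finrank_finsupp_self,
    ← Finset.card_univ (α := σ), ← Finset.card_finsuppAntidiag_nat_eq_choose]
  exact Fintype.card_coe _

instance MvPolynomial.finiteDimensional_homogeneousSubmodule {σ : Type*} [Finite σ] (d : ℕ) :
    FiniteDimensional K (homogeneousSubmodule σ K d) :=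
  Module.Finite.iff_fg.mpr (homogeneousSubmodule_fg σ K d)

theorem hilbDim_pointIdealV_pow_le (v : Fin (n + 1) → K) (hv : v ≠ 0) {m d j k : ℕ}
    (hm : m = k + 1) (hd : d = j + k) :
    hilbDim (pointIdealV v ^ m) d ≤ (n + k).choose k := by
  subst hm hd
  obtain ⟨i₀, hi₀⟩ := Function.ne_iff.mp hv
  let S := homogeneousSubmodule (Fin (n + 1)) K 1
  let L : Submodule K (MvPolynomial (Fin (n + 1)) K) := K ∙ X i₀
  let P := S ⊓ (pointIdealV v).restrictScalars K
  have hX : ∀ i, X i - C (v i / v i₀) * X i₀ ∈ pointIdealV v := fun i =>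
    Ideal.subset_span ⟨Pi.single i 1 - Pi.single i₀ (v i / v i₀), by
      simp [sub_mul, Finset.sum_sub_distrib, Pi.single_apply, ite_mul,
        div_mul_cancel₀ _ hi₀], by
      simp [sub_mul, Finset.sum_sub_distrib, Pi.single_apply, apply_ite C, ite_mul]⟩
  have hLS : L ≤ S := by
    simpa [L, S] using isHomogeneous_X K i₀
  have hS : S = L ⊔ P := by
    refine le_antisymm ?_ (sup_le hLS inf_le_left)
    rw [show S = _ from homogeneousSubmodule_one_eq_span_X, Submodule.span_le]
    rintro _ ⟨i, rfl⟩
    have hmem : C (v i / v i₀) * X i₀ ∈ L := by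
      rw [← smul_eq_C_mul]
      exact Submodule.smul_mem _ _ (Submodule.mem_span_singleton_self _)
    rw [SetLike.mem_coe, ← add_sub_cancel (C (v i / v i₀) * X i₀) (X i)]
    exact Submodule.add_mem_sup hmem
      ⟨sub_mem (isHomogeneous_X K i) (hLS hmem), hX i⟩
  have hle := Submodule.sup_pow_add_le L P (pointIdealV v) inf_le_right k j
  rw [← hS, homogeneousSubmodule_one_pow, homogeneousSubmodule_one_pow] at hle
  let π := (Ideal.Quotient.mkₐ K (pointIdealV v ^ (k + 1))).toLinearMap
  let μ := LinearMap.mulLeft K ((X i₀ : MvPolynomial (Fin (n + 1)) K) ^ j)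
  have hmap : (homogeneousSubmodule (Fin (n + 1)) K (j + k)).map π ≤
      ((homogeneousSubmodule (Fin (n + 1)) K k).map μ).map π := by
    refine (Submodule.map_mono hle).trans ?_
    rw [Submodule.map_sup]
    refine sup_le (Submodule.map_mono ?_) ?_
    · rw [Submodule.span_pow, Set.singleton_pow, Submodule.mul_le]
      intro a ha b hb
      obtain ⟨c, rfl⟩ := Submodule.mem_span_singleton.mp ha
      exact ⟨c • b, Submodule.smul_mem _ c hb, by simp [μ]⟩
    · rintro _ ⟨f, hf, rfl⟩
      have : π f = 0 := Ideal.Quotient.eq_zero_iff_mem.mpr hf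
      rw [this]
      exact zero_mem _
  calc hilbDim (pointIdealV v ^ (k + 1)) (j + k)
      ≤ finrank K (((homogeneousSubmodule (Fin (n + 1)) K k).map μ).map π) :=
        Submodule.finrank_mono hmap
    _ ≤ finrank K ((homogeneousSubmodule (Fin (n + 1)) K k).map μ) := Submodule.finrank_map_le _ _
    _ ≤ finrank K (homogeneousSubmodule (Fin (n + 1)) K k) := Submodule.finrank_map_le _ _
    _ = (n + k).choose k := by
      rw [finrank_homogeneousSubmodule, Fintype.card_fin]
      congr 1
      omega

theorem hilbDim_iInf_le {ι : Type*} [Fintype ι] (I : ι → Ideal (MvPolynomial (Fin (n + 1)) K))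
    (d : ℕ) : hilbDim (⨅ i, I i) d ≤ ∑ i, hilbDim (I i) d := by
  let q : ∀ i, (MvPolynomial (Fin (n + 1)) K ⧸ ⨅ i, I i) →ₗ[K] MvPolynomial (Fin (n + 1)) K ⧸ I i :=
    fun i => (Ideal.Quotient.factorₐ K (iInf_le I i)).toLinearMap
  let M := (homogeneousSubmodule (Fin (n + 1)) K d).map
    (Ideal.Quotient.mkₐ K (⨅ i, I i)).toLinearMap
  let N := fun i => (homogeneousSubmodule (Fin (n + 1)) K d).map
    (Ideal.Quotient.mkₐ K (I i)).toLinearMap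
  have hq : ∀ i, ∀ x ∈ M, q i x ∈ N i := by
    rintro i _ ⟨f, hf, rfl⟩
    exact ⟨f, hf, rfl⟩
  let φ : M →ₗ[K] ∀ i, N i := LinearMap.pi fun i => (q i).restrict (hq i)
  have hφ : Function.Injective φ := by
    refine (injective_iff_map_eq_zero φ).mpr ?_
    rintro ⟨_, f, hf, rfl⟩ h
    refine Subtype.ext (Ideal.Quotient.eq_zero_iff_mem.mpr ?_)
    rw [Submodule.mem_iInf]
    intro i
    exact Ideal.Quotient.eq_zero_iff_mem.mp (congrArg Subtype.val (congrFun h i))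
  have (i : ι) : FiniteDimensional K (N i) := Module.Finite.map _ _
  have (i : ι) : Free K (N i) := Free.of_divisionRing K (N i)
  exact (LinearMap.finrank_le_finrank_of_injective hφ).trans_eq (finrank_pi_fintype K)

end FatPoints

section Taylor

variable {K : Type*} [Field K] {n : ℕ}

/-- The substitution `f ↦ f(x + v)`. -/
noncomputable def taylorShift (v : Fin (n + 1) → K) :
    MvPolynomial (Fin (n + 1)) K →ₐ[K] MvPolynomial (Fin (n + 1)) K :=
  aeval fun i => X i + C (v i)

theorem map_taylorShift_pointIdealV_le (v : Fin (n + 1) → K) :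
    (pointIdealV v).map (taylorShift v) ≤ idealOfVars (Fin (n + 1)) K := by
  rw [pointIdealV, Ideal.map_span, Ideal.span_le]
  rintro _ ⟨_, ⟨c, hc, rfl⟩, rfl⟩
  have h : taylorShift v (∑ i, C (c i) * X i) = ∑ i, C (c i) * X i := by
    have hc' : ∑ i, (C (c i) * C (v i) : MvPolynomial (Fin (n + 1)) K) = 0 := by
      simp_rw [← C_mul, ← map_sum, hc, map_zero]
    simp [taylorShift, mul_add, Finset.sum_add_distrib, hc', algebraMap_eq]
  rw [SetLike.mem_coe, h]
  exact Ideal.sum_mem _ fun i _ => Ideal.mul_mem_left _ _ (Ideal.subset_span ⟨i, rfl⟩)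

theorem coeff_taylorShift_eq_zero (v : Fin (n + 1) → K) {m : ℕ} {f : MvPolynomial (Fin (n + 1)) K}
    (hf : f ∈ pointIdealV v ^ m) {a : Fin (n + 1) →₀ ℕ} (ha : a.degree < m) :
    coeff a (taylorShift v f) = 0 := by
  refine (mem_pow_idealOfVars_iff' m _).mp ?_ a ha
  have := Ideal.mem_map_of_mem (taylorShift v) hf
  rw [Ideal.map_pow] at this
  exact Ideal.pow_right_mono (map_taylorShift_pointIdealV_le v) m this

theorem coeff_taylorShift_monomial (v : Fin (n + 1) → K) (a b : Fin (n + 1) →₀ ℕ) :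
    coeff a (taylorShift v (monomial b 1)) = ∏ i, (b i).choose (a i) * v i ^ (b i - a i) := by
  have hterm : ∀ i m, (X i ^ m * C (v i) ^ (b i - m) * (((b i).choose m : ℕ) : MvPolynomial (Fin (n + 1)) K) :
      MvPolynomial (Fin (n + 1)) K) =
      monomial (Finsupp.single i m) ((b i).choose m * v i ^ (b i - m)) := fun i m => by
    rw [← mul_one (_ * v i ^ _ : K), ← C_mul_monomial, ← X_pow_eq_monomial, C_mul, C_pow,
      map_natCast]
    ring
  have hexp : taylorShift v (monomial b 1) =
      ∑ x ∈ Fintype.piFinset fun i => Finset.range (b i + 1),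
        monomial (Finsupp.equivFunOnFinite.symm x)
          (∏ i, ((b i).choose (x i) * v i ^ (b i - x i) : K)) := by
    rw [monomial_eq, Finsupp.prod_fintype _ _ fun _ => pow_zero _]
    simp only [taylorShift, map_one, one_mul, map_prod, map_pow, aeval_X, add_pow, hterm]
    rw [Finset.prod_univ_sum]
    refine Finset.sum_congr rfl fun x _ => ?_
    rw [← monomial_sum_prod]
    exact congrArg (monomial · _) (Finsupp.univ_sum_single (Finsupp.equivFunOnFinite.symm x))
  rw [hexp, coeff_sum]
  simp_rw [coeff_monomial]
  by_cases ha : ∀ i, a i ≤ b i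
  · rw [Finset.sum_eq_single (a : Fin (n + 1) → ℕ)]
    · simp
    · intro x _ hx
      rw [if_neg]
      rintro rfl
      exact hx rfl
    · intro h
      exact absurd (Fintype.mem_piFinset.mpr fun i => Finset.mem_range_succ_iff.mpr (ha i)) h
  · push Not at ha
    obtain ⟨i, hi⟩ := ha
    rw [Finset.prod_eq_zero (Finset.mem_univ i) (by simp [Nat.choose_eq_zero_of_lt hi])]
    refine Finset.sum_eq_zero fun x hx => if_neg ?_
    rintro rfl
    exact absurd (Finset.mem_range_succ_iff.mp (Fintype.mem_piFinset.mp hx i)) (not_le.mpr hi)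

end Taylor

section Certificate

/-- The exponent vector whose `i`-th entry is the digit of `c` at `10 ^ i`. -/
def decimalDigits (c : ℕ) (i : Fin 5) : ℕ := c / 10 ^ (i : ℕ) % 10

/-- The coefficient of `x ^ a` in the expansion of the monomial `(x + v) ^ b`. -/
def taylorEntry (v : Fin 5 → ℤ) (a b : Fin 5 → ℕ) : ℤ :=
  ∏ i, (b i).choose (a i) * v i ^ (b i - a i)

/-- Integral coordinates of the points `ptsSSSR1`. -/
def integralPoint : Fin 7 → Fin 5 → ℤ :=
  ![![1, 0, 0, 0, 0], ![0, 1, 0, 0, 0], ![0, 0, 1, 0, 0], ![0, 0, 0, 1, 0],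
    ![0, 0, 0, 0, 1], ![1, 1, 1, 1, 0], ![1, 1, -1, 0, 1]]

/-- The coefficient with exponent vector `decimalDigits a` in the Taylor expansion at the `i`-th
point of the polynomial with terms `t.1 * x ^ decimalDigits t.2`, for `t` in `F`. -/
def integralJet (i : Fin 7) (a : ℕ) (F : List (ℤ × ℕ)) : ℤ :=
  (F.map fun t => t.1 * taylorEntry (integralPoint i) (decimalDigits a) (decimalDigits t.2)).sum

/-- The exponent vectors of the quadratic monomials, encoded as decimal numbers. -/
def quadricCode : Fin 15 → ℕ :=
  ![2, 11, 101, 1001, 10001, 20, 110, 1010, 10010, 200, 1100, 10100, 2000, 11000, 20000]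

/-- The second-order Taylor coefficients at the last two points, in an order which makes
`lastPointsQuintic` triangular. -/
def lastPointsJet : Fin 30 → Fin 7 × ℕ :=
  ![(5, 20000), (6, 2000), (5, 10001), (5, 11000), (5, 10010), (5, 10100), (6, 1001), (6, 11000),
    (6, 1010), (6, 1100), (5, 11), (5, 101), (5, 1001), (5, 2), (5, 20), (5, 1010), (5, 2000), (5,
    1100), (5, 110), (5, 200), (6, 2), (6, 20), (6, 11), (6, 101), (6, 110), (6, 200), (6, 10001),
    (6, 10010), (6, 10100), (6, 20000)]

/-- Quintics with multiplicity at least three at the coordinate points, dual to `lastPointsJet` up to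
scaling and earlier members of the list. -/
def lastPointsQuintic : Fin 30 → List (ℤ × ℕ) :=
  ![[(1, 22010), (1, 22100)], [(1, 22010)], [(2, 11012), (-1, 11021), (2, 11102), (1, 11201), (-2,
    12200)], [(1, 12002)], [(1, 12011)], [(1, 12101)], [(2, 11012), (-1, 21020)], [(1, 21002)],
    [(1, 11012)], [(1, 11120)], [(1, 122), (1, 221), (3, 1022), (-3, 1202), (4, 1211), (-4, 1220),
    (-1, 2012), (-1, 2120), (2, 2210), (1, 10022), (-1, 10220), (-1, 20021), (-1, 20120)], [(-1,
    1022), (1, 1202), (1, 2120), (-1, 2210)], [(2, 1121), (1, 2021), (2, 2111), (-3, 2120)], [(1,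
    1022), (1, 2012), (-1, 2021)], [(1, 1202), (-2, 1211), (1, 1220)], [(1, 1022)], [(1, 2021)],
    [(1, 2102)], [(1, 1112)], [(1, 2201)], [(-2, 122), (2, 212), (-3, 221), (6, 20012), (-5,
    20021), (8, 20111), (-6, 20120), (1, 20201)], [(2, 10112), (-2, 10121), (1, 20201), (-1,
    20210)], [(-1, 10202), (2, 10211), (-1, 10220)], [(1, 122), (-1, 212), (1, 221)], [(1, 122)],
    [(1, 212)], [(-2, 10112), (-1, 10220)], [(1, 10022)], [(1, 10112)], [(1, 20210)]]

/-- A point and an exponent vector of degree two for each of the 105 Taylor coefficients. -/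
def jetIndex : Fin 30 ⊕ Fin 5 × Fin 15 → Fin 7 × ℕ :=
  Sum.elim lastPointsJet fun k => (k.1.castLE (by decide), quadricCode k.2)

/-- For each Taylor coefficient, the terms of a quintic on which it does not vanish. -/
def testQuintic : Fin 30 ⊕ Fin 5 × Fin 15 → List (ℤ × ℕ) :=
  Sum.elim lastPointsQuintic fun k => [(1, 3 * 10 ^ (k.1 : ℕ) + quadricCode k.2)]

/-- The order with respect to which `testQuintic` is triangular against `jetIndex`. -/
def jetRank : Fin 30 ⊕ Fin 5 × Fin 15 → ℕ :=
  Sum.elim (fun k => k) fun _ => 30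

theorem sum_decimalDigits_jetIndex : ∀ k, ∑ i, decimalDigits (jetIndex k).2 i = 2 := by
  decide +kernel

theorem sum_decimalDigits_testQuintic :
    ∀ k, ∀ t ∈ testQuintic k, ∑ i, decimalDigits t.2 i = 5 := by
  decide +kernel

theorem integralJet_testQuintic_ne_zero :
    ∀ k, integralJet (jetIndex k).1 (jetIndex k).2 (testQuintic k) ≠ 0 := by
  decide +kernel

theorem integralJet_testQuintic_eq_zero : ∀ k l, l ≠ k → jetRank k ≤ jetRank l →
    integralJet (jetIndex l).1 (jetIndex l).2 (testQuintic k) = 0 := by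
  decide +kernel

end Certificate

section SevenPoints

variable (K : Type*) [Field K]

theorem ptsSSSR1_eq_intCast (i : Fin 7) (j : Fin 5) : ptsSSSR1 K i j = (integralPoint i j : K) := by
  fin_cases i <;> fin_cases j <;> simp [ptsSSSR1, integralPoint]

theorem ptsSSSR1_ne_zero (i : Fin 7) : ptsSSSR1 K i ≠ 0 := by
  have h : ∃ j, ptsSSSR1 K i j = 1 := by
    simp only [ptsSSSR1_eq_intCast]
    have h' : ∃ j, integralPoint i j = 1 := by
      revert i
      decide
    obtain ⟨j, hj⟩ := h'
    exact ⟨j, by rw [hj, Int.cast_one]⟩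
  obtain ⟨j, hj⟩ := h
  intro h0
  simp [h0] at hj

/-- The Taylor coefficient at the `i`-th point with exponent vector `decimalDigits a`. -/
noncomputable def jet (i : Fin 7) (a : ℕ) : MvPolynomial (Fin 5) K →ₗ[K] K :=
  lcoeff K (Finsupp.equivFunOnFinite.symm (decimalDigits a)) ∘ₗ
    (taylorShift (ptsSSSR1 K i)).toLinearMap

/-- The polynomial with terms `t.1 * x ^ decimalDigits t.2`, for `t` in `F`. -/
noncomputable def polynomialOfList (F : List (ℤ × ℕ)) : MvPolynomial (Fin 5) K :=
  (F.map fun t => (t.1 : K) • monomial (Finsupp.equivFunOnFinite.symm (decimalDigits t.2)) 1).sum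

theorem jet_polynomialOfList (i : Fin 7) (a : ℕ) (F : List (ℤ × ℕ)) :
    jet K i a (polynomialOfList K F) = (integralJet i a F : K) := by
  induction F with
  | nil => simp [polynomialOfList, integralJet]
  | cons t F ih =>
    have ht : jet K i a (monomial (Finsupp.equivFunOnFinite.symm (decimalDigits t.2)) 1) =
        (taylorEntry (integralPoint i) (decimalDigits a) (decimalDigits t.2) : K) := by
      refine (coeff_taylorShift_monomial _ _ _).trans ?_
      simp [taylorEntry, ptsSSSR1_eq_intCast]
    simp only [polynomialOfList, integralJet, List.map_cons, List.sum_cons, map_add, map_smul,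
      Int.cast_add, Int.cast_mul, smul_eq_mul, ht] at ih ⊢
    rw [ih]

theorem isHomogeneous_polynomialOfList {d : ℕ} {F : List (ℤ × ℕ)}
    (hF : ∀ t ∈ F, ∑ i, decimalDigits t.2 i = d) : (polynomialOfList K F).IsHomogeneous d := by
  rw [← mem_homogeneousSubmodule]
  refine list_sum_mem fun p hp => ?_
  obtain ⟨t, ht, rfl⟩ := List.mem_map.mp hp
  refine Submodule.smul_mem _ _ (isHomogeneous_monomial 1 ?_)
  rw [Finsupp.degree_eq_sum]
  exact hF t ht

end SevenPoints

/-- **The base case `a = 3` of Lemma `sssr1`** (verified by Macaulay2 Code 1):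
for the scheme `Z` of seven triple points of `ℙ⁴` supported on `e₀,…,e₄`, `e₀+e₁+e₂+e₃`
and `e₀+e₁−e₂+e₄`, one has `dim_K (R/I_Z)₅ = 7·C(6,4) = 105`, i.e. `h¹(I_Z(5)) = 0`. -/
theorem seven_triple_points_P4 {K : Type*} [Field K] [CharZero K] :
    hilbDim (n := 4) (⨅ i : Fin 7, pointIdealV (n := 4) (ptsSSSR1 K i) ^ 3) 5 = 105 := by
  apply le_antisymm
  · have hpoint : ∀ i : Fin 7, hilbDim (n := 4) (pointIdealV (n := 4) (ptsSSSR1 K i) ^ 3) 5 ≤ 15 :=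
      fun i => hilbDim_pointIdealV_pow_le (n := 4) (ptsSSSR1 K i) (ptsSSSR1_ne_zero K i)
        (m := 3) (d := 5) (j := 3) (k := 2) rfl rfl
    calc hilbDim (n := 4) (⨅ i : Fin 7, pointIdealV (n := 4) (ptsSSSR1 K i) ^ 3) 5
        ≤ ∑ i : Fin 7, hilbDim (n := 4) (pointIdealV (n := 4) (ptsSSSR1 K i) ^ 3) 5 :=
          hilbDim_iInf_le _ 5
      _ ≤ ∑ _i : Fin 7, 15 := Finset.sum_le_sum fun i _ => hpoint i
      _ = 105 := by simp
  · have h := card_le_finrank_map_of_triangular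
      (Ideal.Quotient.mkₐ K (⨅ i : Fin 7, pointIdealV (n := 4) (ptsSSSR1 K i) ^ 3)).toLinearMap
      (homogeneousSubmodule (Fin 5) K 5) jetRank
      (fun k => jet K (jetIndex k).1 (jetIndex k).2) (fun k => polynomialOfList K (testQuintic k))
      (fun k f hf => by
        have hf' := (Submodule.mem_iInf _).mp (Ideal.Quotient.eq_zero_iff_mem.mp hf) (jetIndex k).1
        refine coeff_taylorShift_eq_zero _ hf' ?_
        rw [Finsupp.degree_eq_sum]
        exact (sum_decimalDigits_jetIndex k).trans_lt (by decide))
      (fun k => isHomogeneous_polynomialOfList K (sum_decimalDigits_testQuintic k))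
      (fun k => by
        rw [jet_polynomialOfList]
        exact Int.cast_ne_zero.mpr (integralJet_testQuintic_ne_zero k))
      (fun k l hl hr => by
        rw [jet_polynomialOfList, integralJet_testQuintic_eq_zero k l hl hr, Int.cast_zero])
    have hcard : Fintype.card (Fin 30 ⊕ Fin 5 × Fin 15) = 105 := by simp
    exact hcard ▸ h
end

section
/- Let K be a field of characteristic zero, let e_0,…,e_5 be the coordinate points of P^5 over K, and let S ⊂ P^5 consist of the eight points e_0, e_1, e_2, e_3, e_4, e_5, [1:1:1:1:0:0] (the point e_0+e_1+e_2+e_3) and [1:1:0:0:1:1] (the point e_0+e_1+e_4+e_5). Let Z = Σ_{p ∈ S} 2·p be the scheme of eight double points supported on S. Then dim_K (R/I_Z)_3 = 8·6 = 48, i.e. h^1(I_Z(3)) = 0. -/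
open MvPolynomial Module

/-- The eight points of `ℙ⁵` of Case (b.1.2) (Macaulay2 Code 2): the six coordinate points
`e₀,…,e₅` together with `e₀+e₁+e₂+e₃` and `e₀+e₁+e₄+e₅`. -/
noncomputable def ptsB12 (K : Type*) [Field K] : Fin 8 → Fin 6 → K :=
  ![![1, 0, 0, 0, 0, 0], ![0, 1, 0, 0, 0, 0], ![0, 0, 1, 0, 0, 0], ![0, 0, 0, 1, 0, 0],
    ![0, 0, 0, 0, 1, 0], ![0, 0, 0, 0, 0, 1], ![1, 1, 1, 1, 0, 0], ![1, 1, 0, 0, 1, 1]]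

section GradientCriterion

variable {K : Type*} [Field K] {n : ℕ}

/-- First-order Taylor expansion of a polynomial at `b`, modulo the square of an ideal containing
the increments `a i - b i`. -/
theorem MvPolynomial.aeval_sub_aeval_sub_sum_mem_sq {σ R S : Type*} [Fintype σ] [CommRing R]
    [CommRing S] [Algebra R S] (I : Ideal S) (a b : σ → S) (hab : ∀ i, a i - b i ∈ I)
    (f : MvPolynomial σ R) :
    aeval a f - aeval b f - ∑ i, (a i - b i) * aeval b (pderiv i f) ∈ I ^ 2 := by
  classical
  induction f using MvPolynomial.induction_on with
  | C r => simp
  | add p q hp hq =>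
    convert! add_mem hp hq using 1
    simp only [map_add, mul_add, Finset.sum_add_distrib]
    ring
  | mul_X p k hp =>
    have hD : ∑ i, (a i - b i) * aeval b (pderiv i p) ∈ I :=
      sum_mem fun i _ ↦ I.mul_mem_right _ (hab i)
    have hDk : (∑ i, (a i - b i) * aeval b (pderiv i p)) * (a k - b k) ∈ I ^ 2 := by
      rw [pow_two]
      exact Ideal.mul_mem_mul hD (hab k)
    have hsum : ∑ i, (a i - b i) * aeval b (pderiv i (p * X k)) =
        (∑ i, (a i - b i) * aeval b (pderiv i p)) * b k + (a k - b k) * aeval b p := by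
      simp only [pderiv_mul, pderiv_X, map_add, map_mul, aeval_X, mul_add,
        Finset.sum_add_distrib, Finset.sum_mul, mul_assoc]
      congr 1
      rw [Finset.sum_eq_single k]
      · simp
      · intro i _ hi
        simp [Pi.single_eq_of_ne hi.symm]
      · simp
    rw [hsum]
    convert! add_mem (Ideal.mul_mem_right (a k) _ hp) hDk using 1
    simp only [map_mul, aeval_X]
    ring

theorem MvPolynomial.IsHomogeneous.aeval_C_mul {σ R : Type*} [CommRing R] [Fintype σ]
    {f : MvPolynomial σ R} {d : ℕ} (hf : f.IsHomogeneous d) (v : σ → R) (t : MvPolynomial σ R) :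
    MvPolynomial.aeval (fun i ↦ C (v i) * t) f = C (eval v f) * t ^ d := by
  rw [aeval_def, eval₂_eq', eval_eq', map_sum, Finset.sum_mul]
  refine Finset.sum_congr rfl fun m hm ↦ ?_
  have hd : ∑ i, m i = d := by
    rw [← Finsupp.degree_eq_sum]
    exact hf.degree_eq_sum_deg_support hm |>.symm
  simp only [mul_pow, Finset.prod_mul_distrib, Finset.prod_pow_eq_pow_sum, hd, map_mul, map_prod,
    map_pow, algebraMap_eq]
  ring

theorem eval_eq_zero_of_mem_pointIdealV {v : Fin (n + 1) → K}
    {f : MvPolynomial (Fin (n + 1)) K} (hf : f ∈ pointIdealV v) : eval v f = 0 := by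
  have hle : pointIdealV v ≤ RingHom.ker (eval v) := by
    refine Ideal.span_le.mpr ?_
    rintro _ ⟨c, hc, rfl⟩
    simpa [RingHom.mem_ker] using hc
  exact hle hf

theorem eval_pderiv_eq_zero_of_mem_pointIdealV_sq {v : Fin (n + 1) → K}
    {f : MvPolynomial (Fin (n + 1)) K} (hf : f ∈ pointIdealV v ^ 2) (j : Fin (n + 1)) :
    eval v (pderiv j f) = 0 := by
  rw [pow_two] at hf
  refine Submodule.mul_induction_on hf (fun p hp q hq ↦ ?_) fun p q hp hq ↦ ?_
  · simp [eval_eq_zero_of_mem_pointIdealV hp, eval_eq_zero_of_mem_pointIdealV hq]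
  · simp [hp, hq]

theorem X_sub_C_mul_X_mem_pointIdealV {v : Fin (n + 1) → K} {k : Fin (n + 1)} (hk : v k = 1)
    (i : Fin (n + 1)) : X i - C (v i) * X k ∈ pointIdealV v := by
  refine Ideal.subset_span ⟨Pi.single i 1 - Pi.single k (v i), ?_, ?_⟩
  · simp [sub_mul, Finset.sum_sub_distrib, Pi.single_apply, ite_mul, hk]
  · simp [sub_mul, Finset.sum_sub_distrib, Pi.single_apply, apply_ite C, ite_mul]

theorem MvPolynomial.IsHomogeneous.mem_pointIdealV_sq_iff {v : Fin (n + 1) → K}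
    {k : Fin (n + 1)} (hk : v k = 1) {d : ℕ} (hd : (d : K) ≠ 0)
    {f : MvPolynomial (Fin (n + 1)) K} (hf : f.IsHomogeneous d) :
    f ∈ pointIdealV v ^ 2 ↔ ∀ j, eval v (pderiv j f) = 0 := by
  refine ⟨eval_pderiv_eq_zero_of_mem_pointIdealV_sq, fun h ↦ ?_⟩
  have hf0 : eval v f = 0 := by
    have := congrArg (eval v) hf.sum_X_mul_pderiv
    simpa [h, hd] using this
  have := aeval_sub_aeval_sub_sum_mem_sq (pointIdealV v) X (fun i ↦ C (v i) * X k)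
    (X_sub_C_mul_X_mem_pointIdealV hk) f
  simp only [hf.aeval_C_mul, hf.pderiv.aeval_C_mul, h, hf0] at this
  simpa using this

/-- The linear map sending a polynomial to its gradients at a family of points. -/
noncomputable def gradientAt {ι σ : Type*} (P : ι → σ → K) :
    MvPolynomial σ K →ₗ[K] ι → σ → K :=
  LinearMap.pi fun i ↦ LinearMap.pi fun j ↦ (aeval (P i)).toLinearMap ∘ₗ (pderiv j).toLinearMap

@[simp]
theorem gradientAt_apply {ι σ : Type*} (P : ι → σ → K) (f : MvPolynomial σ K) (i : ι) (j : σ) :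
    gradientAt P f i j = eval (P i) (pderiv j f) := by
  simp [gradientAt, aeval_eq_eval]

theorem Submodule.finrank_map_eq_finrank_map {V W₁ W₂ : Type*} [AddCommGroup V] [Module K V]
    [AddCommGroup W₁] [Module K W₁] [AddCommGroup W₂] [Module K W₂] (H : Submodule K V)
    (φ : V →ₗ[K] W₁) (ψ : V →ₗ[K] W₂) (h : ∀ x ∈ H, φ x = 0 ↔ ψ x = 0) :
    finrank K (H.map φ) = finrank K (H.map ψ) := by
  have hker : LinearMap.ker (φ.domRestrict H) = LinearMap.ker (ψ.domRestrict H) := by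
    ext x
    simpa using h x x.2
  rw [← LinearMap.range_domRestrict, ← LinearMap.range_domRestrict]
  exact ((φ.domRestrict H).quotKerEquivRange.symm.trans
    ((Submodule.quotEquivOfEq _ _ hker).trans (ψ.domRestrict H).quotKerEquivRange)).finrank_eq

/-- The Hilbert function of a scheme of double points is the rank of the gradient map. -/
theorem hilbDim_iInf_pointIdealV_sq {ι : Type*} (P : ι → Fin (n + 1) → K)
    (hP : ∀ i, ∃ k, P i k = 1) {d : ℕ} (hd : (d : K) ≠ 0) :
    hilbDim (⨅ i, pointIdealV (P i) ^ 2) d =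
      finrank K ((homogeneousSubmodule (Fin (n + 1)) K d).map (gradientAt P)) := by
  refine Submodule.finrank_map_eq_finrank_map _ _ _ fun f hf ↦ ?_
  have hI : f ∈ ⨅ i, pointIdealV (P i) ^ 2 ↔ ∀ i j, eval (P i) (pderiv j f) = 0 := by
    rw [Submodule.mem_iInf]
    refine forall_congr' fun i ↦ ?_
    obtain ⟨k, hk⟩ := hP i
    exact IsHomogeneous.mem_pointIdealV_sq_iff hk hd hf
  simpa [Ideal.Quotient.eq_zero_iff_mem, funext_iff] using hI

end GradientCriterion

section EightPoints

variable (K : Type*) [Field K]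

theorem ptsB12_castLE (b : Fin 6) : ptsB12 K (b.castLE (by simp)) = Pi.single b 1 := by
  ext k
  fin_cases b <;> fin_cases k <;> simp [ptsB12]

theorem exists_ptsB12_eq_one (i : Fin 8) : ∃ k, ptsB12 K i k = 1 := by
  fin_cases i
  exacts [⟨0, rfl⟩, ⟨1, rfl⟩, ⟨2, rfl⟩, ⟨3, rfl⟩, ⟨4, rfl⟩, ⟨5, rfl⟩, ⟨0, rfl⟩, ⟨0, rfl⟩]

variable {K}

theorem isHomogeneous_X_mul_X_mul_X {σ : Type*} (a b c : σ) :
    (X a * X b * X c : MvPolynomial σ K).IsHomogeneous 3 :=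
  ((isHomogeneous_X K a).mul (isHomogeneous_X K b)).mul (isHomogeneous_X K c)

theorem eval_pderiv_X_mul_X_mul_X {σ : Type*} [DecidableEq σ] (v : σ → K) (j a b c : σ) :
    eval v (pderiv j (X a * X b * X c : MvPolynomial σ K)) =
      (if a = j then v b * v c else 0) + (if b = j then v a * v c else 0) +
        (if c = j then v a * v b else 0) := by
  simp only [pderiv_mul, pderiv_X, Pi.single_apply, map_add, map_mul, eval_X]
  split_ifs <;> simp <;> ring

variable [CharZero K]

/-- Cubics singular at the six coordinate points have arbitrary gradients at the other two
points. -/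
theorem mem_map_gradientAt_ptsB12_of_eq_zero (w : Fin 8 → Fin 6 → K)
    (hw : ∀ b : Fin 6, w (b.castLE (by simp)) = 0) :
    w ∈ (homogeneousSubmodule (Fin 6) K 3).map (gradientAt (ptsB12 K)) := by
  let m (a b c : Fin 6) : MvPolynomial (Fin 6) K := X a * X b * X c
  have hm (r : K) (a b c : Fin 6) : r • m a b c ∈ homogeneousSubmodule (Fin 6) K 3 :=
    Submodule.smul_mem _ _ (isHomogeneous_X_mul_X_mul_X a b c)
  have hm₀ (b j a₁ a₂ a₃ : Fin 6) (h₁₂ : a₁ ≠ a₂) (h₁₃ : a₁ ≠ a₃) (h₂₃ : a₂ ≠ a₃) :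
      eval (Pi.single b 1) (pderiv j (m a₁ a₂ a₃)) = 0 := by
    simp only [m, eval_pderiv_X_mul_X_mul_X, Pi.single_apply]
    split_ifs <;> simp_all
  obtain ⟨s, hs⟩ : ∃ s, 3 * s = w 6 0 + w 6 1 + w 6 2 + w 6 3 :=
    ⟨_, mul_div_cancel₀ _ three_ne_zero⟩
  obtain ⟨t, ht⟩ : ∃ t, 3 * t = w 7 0 + w 7 1 + w 7 4 + w 7 5 :=
    ⟨_, mul_div_cancel₀ _ three_ne_zero⟩
  refine ⟨(s - w 6 3) • m 0 1 2 + (s - w 6 2) • m 0 1 3 + (s - w 6 1) • m 0 2 3 +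
    (s - w 6 0) • m 1 2 3 + (t - w 7 5) • m 0 1 4 + (t - w 7 4) • m 0 1 5 +
    (t - w 7 1) • m 0 4 5 + (t - w 7 0) • m 1 4 5 +
    (w 6 4 - (t - w 7 5)) • m 2 3 4 + (w 6 5 - (t - w 7 4)) • m 2 3 5 +
    (w 7 2 - (s - w 6 3)) • m 2 4 5 + (w 7 3 - (s - w 6 2)) • m 3 4 5, ?_, ?_⟩
  · iterate 11 refine Submodule.add_mem _ ?_ (hm _ _ _ _)
    exact hm _ _ _ _
  · ext i j
    simp only [gradientAt_apply, map_add, Derivation.map_smul, smul_eval]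
    obtain ⟨b, rfl⟩ | rfl | rfl : (∃ b : Fin 6, i = b.castLE (by simp)) ∨ i = 6 ∨ i = 7 := by
      revert i
      decide
    · simp [hw, ptsB12_castLE, hm₀]
    · have hv : ptsB12 K 6 = ![1, 1, 1, 1, 0, 0] := rfl
      simp only [m, eval_pderiv_X_mul_X_mul_X, hv]
      fin_cases j <;> simp <;> first | ring1 | linear_combination hs
    · have hv : ptsB12 K 7 = ![1, 1, 0, 0, 1, 1] := rfl
      simp only [m, eval_pderiv_X_mul_X_mul_X, hv]
      fin_cases j <;> simp <;> first | ring1 | linear_combination ht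

theorem map_gradientAt_ptsB12_eq_top :
    (homogeneousSubmodule (Fin 6) K 3).map (gradientAt (ptsB12 K)) = ⊤ := by
  refine eq_top_iff.mpr fun g _ ↦ ?_
  let c (a j : Fin 6) : K :=
    if a = j then g (a.castLE (by simp)) j / 3 else g (a.castLE (by simp)) j
  let F : MvPolynomial (Fin 6) K := ∑ a, ∑ j, c a j • (X a * X a * X j)
  have hF : F ∈ homogeneousSubmodule (Fin 6) K 3 :=
    sum_mem fun a _ ↦ sum_mem fun j _ ↦
      Submodule.smul_mem _ _ (isHomogeneous_X_mul_X_mul_X a a j)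
  rw [← add_sub_cancel (gradientAt (ptsB12 K) F) g]
  refine add_mem (Submodule.mem_map_of_mem hF)
    (mem_map_gradientAt_ptsB12_of_eq_zero _ fun b ↦ ?_)
  ext k
  have hterm (a j : Fin 6) : eval (Pi.single b 1)
      (pderiv k (X a * X a * X j : MvPolynomial (Fin 6) K)) =
        if a = b then (if j = k then (if j = b then 3 else 1) else 0) else 0 := by
    rw [eval_pderiv_X_mul_X_mul_X]
    simp only [Pi.single_apply]
    split_ifs <;> simp_all
    norm_num
  rw [Pi.sub_apply, Pi.sub_apply, gradientAt_apply, ptsB12_castLE]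
  simp only [F, map_sum, Derivation.map_smul, smul_eval, hterm]
  simp only [mul_ite, mul_zero, mul_one, Finset.sum_ite_irrel, Finset.sum_const_zero,
    Finset.sum_ite_eq', Finset.mem_univ, if_true, c]
  obtain rfl | h := eq_or_ne k b
  · simp
  · simp [h, h.symm]

end EightPoints

/-- **The case `(n,m) = (5,2)` of Case (b.1.2)** (verified by Macaulay2 Code 2):
for the scheme `Z` of eight double points of `ℙ⁵` supported on `e₀,…,e₅`, `e₀+e₁+e₂+e₃`
and `e₀+e₁+e₄+e₅`, one has `dim_K (R/I_Z)₃ = 8·6 = 48`, i.e. `h¹(I_Z(3)) = 0`. -/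
theorem eight_double_points_P5 {K : Type*} [Field K] [CharZero K] :
    hilbDim (n := 5) (⨅ i : Fin 8, pointIdealV (n := 5) (ptsB12 K i) ^ 2) 3 = 48 := by
  rw [hilbDim_iInf_pointIdealV_sq _ (exists_ptsB12_eq_one K) (by norm_num),
    map_gradientAt_ptsB12_eq_top, finrank_top]
  simp [Module.finrank_pi_fintype]
end
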